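/- arXiv:2503.05259 — 2 statements merged into one kernel-verified Lean document; each statement's English description precedes it below -/
import Mathlib

section
/- In G₇ set v = s·u·s and w = z³·s, let G₄ be the subgroup generated by u and v, let Z₄ = {1, z⁶}, U = {1, u, u²}, and X₄ = {1, v, w, w·u}. Then X₄ = (X₆ ∪ z³·X₆) ∩ G₄ where X₆ = {1, s, s·u, s·u·s}, and the map Z₄ × U × X₄ → G₄ sending (y, v', x) to y·v'·x is a bijection onto G₄. -/
open Pointwise

namespace Tetra

def rels : Set (FreeGroup (Fin 3)) :=
  { FreeGroup.of 0 ^ 2, FreeGroup.of 1 ^ 3, FreeGroup.of 2 ^ 3,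
    FreeGroup.of 0 * FreeGroup.of 1 * FreeGroup.of 2 *
      (FreeGroup.of 1 * FreeGroup.of 2 * FreeGroup.of 0)⁻¹,
    FreeGroup.of 0 * FreeGroup.of 1 * FreeGroup.of 2 *
      (FreeGroup.of 2 * FreeGroup.of 0 * FreeGroup.of 1)⁻¹ }

/-- The group `G₇ = ⟨s, t, u | s² = t³ = u³ = 1, stu = tus = ust⟩`. -/
abbrev G7 := PresentedGroup rels

def s : G7 := PresentedGroup.of 0
def t : G7 := PresentedGroup.of 1
def u : G7 := PresentedGroup.of 2
def z : G7 := s * t * u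

def v : G7 := s * u * s
def w : G7 := z ^ 3 * s
def G4 : Subgroup G7 := Subgroup.closure {u, v}

theorem grp_facts {G : Type*} [Group G] {u v w : G} (hu : u ^ 3 = 1)
    (h1 : u * v * u = w) (h2 : v * u * v = w) (hv : v ^ 3 = 1) :
    v * u = u ^ 2 * w ∧ w * u * u = u * v ∧ v * v = (w * w) * u * (w * u) ∧
    w * v = u * w ∧ w * u * v = (w * w) * u ^ 2 ∧ (w * w) ^ 2 = 1 ∧
    Commute (w * w) u := by
  have wu : w * u = v * w := by
    rw [← h2]
    have : v * u * v * u = v * (u * v * u) := by group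
    rw [this, h1, h2]
  have wv : w * v = u * w := by
    rw [← h1]
    have : u * v * u * v = u * (v * u * v) := by group
    rw [this, h2, h1]
  have hc : Commute (w * w) u := by
    show w * w * u = u * (w * w)
    rw [mul_assoc, wu, ← mul_assoc, wv, mul_assoc]
  have vu : v * u = u ^ 2 * w := by
    rw [← h1]
    calc v * u = u ^ 3 * (v * u) := by rw [hu, one_mul]
      _ = _ := by group
  have wuv : w * u * v = (w * w) * u ^ 2 := by
    rw [wu, mul_assoc, wv, ← mul_assoc, vu, mul_assoc, (hc.pow_right 2).eq]
  -- `v * v * (w * w) = u * w * u`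
  have vv : v * v * (w * w) = u * w * u := by
    have e : u * w * u * v = w * w := by
      have : u * w * u * v = u * (w * u * v) := by group
      rw [this, wuv, (hc.pow_right 2).eq, ← mul_assoc, ← pow_succ', hu, one_mul]
    have hcv : w * w * v = v * (w * w) := by
      rw [mul_assoc, wv, ← mul_assoc, wu, mul_assoc]
    calc v * v * (w * w) = w * w * v * v := by
          rw [mul_assoc, ← hcv, ← mul_assoc, ← hcv]
      _ = u * w * u * v ^ 3 := by rw [← e]; simp only [pow_succ, pow_zero, one_mul, mul_assoc]
      _ = _ := by rw [hv, mul_one]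
  have wuu : w * u * u = u * v := by
    have e : w * u * u = v * v * w := by
      rw [wu, mul_assoc, wu, ← mul_assoc]
    rw [e]
    have : v * v * w * w * w = u * v * w * w := by
      calc v * v * w * w * w = v * v * (w * w) * w := by group
        _ = u * (w * u) * w := by rw [vv]; group
        _ = _ := by rw [wu]; group
    exact mul_right_cancel (mul_right_cancel this)
  have cc : (w * w) ^ 2 = 1 := by
    have hcv : Commute (w * w) v := by
      show w * w * v = v * (w * w)
      rw [mul_assoc, wv, ← mul_assoc, wu, mul_assoc]
    have hcw : Commute (w * w) w := (Commute.refl w).mul_left (Commute.refl w)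
    have v4 : v * v * (v * v) = v := by
      calc v * v * (v * v) = v ^ 3 * v := by simp only [pow_succ, pow_zero, one_mul, mul_assoc]
        _ = v := by rw [hv, one_mul]
    -- `(v² c)² = u² v² w`
    have e1 : v * (w * w) ^ 2 = u * u * (v * v) * w := by
      calc v * (w * w) ^ 2 = v * v * (v * v) * (w * w) * (w * w) := by
            rw [v4, sq]; simp only [mul_assoc]
        _ = v * v * ((v * v) * (w * w)) * (w * w) := by simp only [mul_assoc]
        _ = (v * v * (w * w)) * (v * v * (w * w)) := by
            rw [mul_assoc (v * v) (w * w) (v * v * (w * w)), ← mul_assoc (w * w) (v * v) (w * w),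
              (hcv.mul_right hcv).eq]
            simp only [mul_assoc]
        _ = u * (w * u * u) * (w * u) := by rw [vv]; simp only [mul_assoc]
        _ = u * u * v * (w * u) := by rw [wuu]; simp only [mul_assoc]
        _ = _ := by rw [wu]; simp only [mul_assoc]
    have e2 : v * (w * w) ^ 2 * (w * w) = v * (w * w) := by
      calc v * (w * w) ^ 2 * (w * w) = u * u * (v * v * (w * w)) * w := by
            rw [e1]; simp only [mul_assoc]
        _ = u ^ 3 * (w * u) * w := by
            rw [vv]; simp only [pow_succ, pow_zero, one_mul, mul_assoc]
        _ = _ := by rw [hu, wu, one_mul, mul_assoc]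
    have e3 := mul_right_cancel e2
    exact mul_eq_left.mp e3
  refine ⟨vu, wuu, ?_, wv, wuv, cc, hc⟩
  have : v * v * (w * w) * (w * w) = u * w * u * (w * w) := by rw [vv]
  rw [mul_assoc, ← sq (w * w), cc, mul_one] at this
  rw [this, mul_assoc, ← hc.eq]
  calc u * w * (w * w * u) = u * (w * w) * (w * u) := by group
    _ = _ := by rw [← hc.eq]

def M (g : Fin 3) : (Matrix (Fin 2) (Fin 2) (ZMod 13))ˣ :=
  match g with
  | 0 => ⟨!![1, 0; 0, 12], !![1, 0; 0, 12], by decide, by decide⟩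
  | 1 => ⟨!![5, 6; 3, 12], !![5, 6; 3, 12] * !![5, 6; 3, 12], by decide, by decide⟩
  | 2 => ⟨!![2, 1; 6, 10], !![2, 1; 6, 10] * !![2, 1; 6, 10], by decide, by decide⟩

theorem M_rels : ∀ r ∈ rels, FreeGroup.lift M r = 1 := by
  intro r hr
  simp only [rels, Set.mem_insert_iff, Set.mem_singleton_iff] at hr
  rcases hr with rfl | rfl | rfl | rfl | rfl <;>
    simp only [map_mul, map_pow, map_inv, FreeGroup.lift_apply_of, mul_inv_eq_one] <;>
    (apply Units.ext; decide)

def phi : G7 →* (Matrix (Fin 2) (Fin 2) (ZMod 13))ˣ := PresentedGroup.toGroup M_rels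

def P (g : Fin 3) : Multiplicative (ZMod 2) :=
  match g with
  | 0 => Multiplicative.ofAdd 1
  | 1 => 1
  | 2 => 1

theorem P_rels : ∀ r ∈ rels, FreeGroup.lift P r = 1 := by
  intro r hr
  simp only [rels, Set.mem_insert_iff, Set.mem_singleton_iff] at hr
  rcases hr with rfl | rfl | rfl | rfl | rfl <;>
    simp only [map_mul, map_pow, map_inv, FreeGroup.lift_apply_of, mul_inv_eq_one] <;>
    decide

def psi : G7 →* Multiplicative (ZMod 2) := PresentedGroup.toGroup P_rels

theorem phi_s : phi s = M 0 := PresentedGroup.toGroup.of M_rels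
theorem phi_t : phi t = M 1 := PresentedGroup.toGroup.of M_rels
theorem phi_u : phi u = M 2 := PresentedGroup.toGroup.of M_rels
theorem psi_s : psi s = P 0 := PresentedGroup.toGroup.of P_rels
theorem psi_t : psi t = P 1 := PresentedGroup.toGroup.of P_rels
theorem psi_u : psi u = P 2 := PresentedGroup.toGroup.of P_rels

theorem s2 : s ^ 2 = 1 := by
  exact PresentedGroup.one_of_mem (rels := rels) (x := FreeGroup.of 0 ^ 2) (by simp [rels])
theorem t3 : t ^ 3 = 1 := by
  exact PresentedGroup.one_of_mem (rels := rels) (x := FreeGroup.of 1 ^ 3) (by simp [rels])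
theorem u3 : u ^ 3 = 1 := by
  exact PresentedGroup.one_of_mem (rels := rels) (x := FreeGroup.of 2 ^ 3) (by simp [rels])
theorem r1 : s * t * u = t * u * s := by
  exact PresentedGroup.mk_eq_mk_of_mul_inv_mem (rels := rels)
    (x := FreeGroup.of 0 * FreeGroup.of 1 * FreeGroup.of 2)
    (y := FreeGroup.of 1 * FreeGroup.of 2 * FreeGroup.of 0) (by simp [rels])
theorem r2 : s * t * u = u * s * t := by
  exact PresentedGroup.mk_eq_mk_of_mul_inv_mem (rels := rels)
    (x := FreeGroup.of 0 * FreeGroup.of 1 * FreeGroup.of 2)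
    (y := FreeGroup.of 2 * FreeGroup.of 0 * FreeGroup.of 1) (by simp [rels])

theorem ss : s * s = 1 := by rw [← sq, s2]

theorem zs : Commute z s := by
  show s * t * u * s = s * (s * t * u)
  nth_rewrite 2 [r1]
  simp only [mul_assoc]

theorem zu : Commute z u := by
  show s * t * u * u = u * (s * t * u)
  nth_rewrite 1 [r2]
  group

theorem us3 : (u * s) ^ 3 = z ^ 3 := by
  have ht : t = (s⁻¹ * z) * u⁻¹ := by unfold z; group
  have ht_b : t⁻¹ = z⁻¹ * (u * s) := by
    rw [ht, zs.symm.inv_left.eq, mul_inv_rev, mul_inv_rev, inv_inv, inv_inv, ← mul_assoc,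
      ← (zu.mul_right zs).inv_left.eq]
  have hc : Commute z⁻¹ (u * s) := (zu.mul_right zs).inv_left
  have := t3
  have h : (t⁻¹) ^ 3 = 1 := by rw [inv_pow, t3, inv_one]
  rw [ht_b, hc.mul_pow, inv_pow, inv_mul_eq_one] at h
  exact h.symm

theorem uvu : u * v * u = w := by
  have h : u * v * u * s = z ^ 3 := by
    rw [← us3]; unfold v; simp only [pow_succ, pow_zero, one_mul, mul_assoc]
  unfold w
  rw [← h, mul_assoc _ s s, ss, mul_one]

theorem vuv : v * u * v = w := by
  have h : v * u * v = s * (u * s) ^ 3 := by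
    unfold v; simp only [pow_succ, pow_zero, one_mul, mul_assoc]
  rw [h, us3]
  exact (zs.pow_left 3).eq.symm

theorem ww : w * w = z ^ 6 := by
  unfold w
  have := (zs.pow_left 3).eq
  rw [mul_assoc, ← mul_assoc s, ← this, mul_assoc, ss, mul_one, ← pow_add]

theorem v3 : v ^ 3 = 1 := by
  have h : v = s * u * s⁻¹ := by unfold v; rw [inv_eq_of_mul_eq_one_left ss]
  rw [h, conj_pow, u3, mul_one, mul_inv_cancel]

theorem uG : u ∈ G4 := Subgroup.subset_closure (by simp)
theorem vG : v ∈ G4 := Subgroup.subset_closure (by simp)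
theorem wG : w ∈ G4 := by
  rw [← uvu]; exact mul_mem (mul_mem uG vG) uG

theorem psi_G4 : ∀ g ∈ G4, psi g = 1 := by
  intro g hg
  have : G4 ≤ psi.ker := by
    unfold G4
    rw [Subgroup.closure_le]
    intro x hx
    simp only [Set.mem_insert_iff, Set.mem_singleton_iff] at hx
    rcases hx with rfl | rfl
    · show psi u = 1
      rw [psi_u]; rfl
    · show psi (s * u * s) = 1
      rw [map_mul, map_mul, psi_u, psi_s]; decide
  exact this hg

/-- Elements in normal form. -/
def NF (g : G7) : Prop :=
  ∃ (i j : ℕ) (x : G7), (x = 1 ∨ x = v ∨ x = w ∨ x = w * u) ∧ g = (w * w) ^ i * u ^ j * x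

theorem NF_u {g : G7} (h : NF g) : NF (g * u) := by
  obtain ⟨vu, wuu, vv, wv, wuv, cc, hc⟩ := grp_facts u3 uvu vuv v3
  obtain ⟨i, j, x, hx, rfl⟩ := h
  rcases hx with rfl | rfl | rfl | rfl
  · exact ⟨i, j + 1, 1, by simp, by simp [pow_succ, mul_assoc]⟩
  · refine ⟨i, j + 2, w, by simp, ?_⟩
    rw [mul_assoc, vu, pow_add]; simp only [mul_assoc]
  · exact ⟨i, j, w * u, by simp, by simp only [mul_assoc]⟩
  · refine ⟨i, j + 1, v, by simp, ?_⟩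
    rw [mul_assoc, wuu, pow_add, pow_one]; simp only [mul_assoc]

theorem NF_v {g : G7} (h : NF g) : NF (g * v) := by
  obtain ⟨vu, wuu, vv, wv, wuv, cc, hc⟩ := grp_facts u3 uvu vuv v3
  have key : ∀ (i j k : ℕ) (y : G7), (w * w) ^ i * u ^ j * ((w * w) * u ^ k * y) =
      (w * w) ^ (i + 1) * u ^ (j + k) * y := by
    intro i j k y
    calc _ = (w * w) ^ i * (u ^ j * (w * w)) * u ^ k * y := by simp only [mul_assoc]
      _ = _ := by
        rw [← (hc.pow_right j).eq, pow_add, pow_add, pow_one]; simp only [mul_assoc]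
  obtain ⟨i, j, x, hx, rfl⟩ := h
  rcases hx with rfl | rfl | rfl | rfl
  · exact ⟨i, j, v, by simp, by simp⟩
  · refine ⟨i + 1, j + 1, w * u, by simp, ?_⟩
    rw [← key, mul_assoc, vv, pow_one]
  · refine ⟨i, j + 1, w, by simp, ?_⟩
    rw [mul_assoc, wv, pow_add, pow_one]; simp only [mul_assoc]
  · refine ⟨i + 1, j + 2, 1, by simp, ?_⟩
    rw [← key, mul_assoc, wuv, mul_one]

theorem NF_G4 {g : G7} (h : g ∈ G4) : NF g := by
  have ui : u⁻¹ = u * u := by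
    rw [inv_eq_iff_mul_eq_one, ← mul_assoc]; simpa [pow_succ] using u3
  have vi : v⁻¹ = v * v := by
    rw [inv_eq_iff_mul_eq_one, ← mul_assoc]; simpa [pow_succ] using v3
  unfold G4 at h
  induction h using Subgroup.closure_induction_right with
  | one => exact ⟨0, 0, 1, by simp, by simp⟩
  | mul_right x hx y hy ih =>
    simp only [Set.mem_insert_iff, Set.mem_singleton_iff] at hy
    rcases hy with rfl | rfl
    · exact NF_u ih
    · exact NF_v ih
  | mul_inv_cancel x hx y hy ih =>
    simp only [Set.mem_insert_iff, Set.mem_singleton_iff] at hy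
    rcases hy with rfl | rfl
    · rw [ui, ← mul_assoc]; exact NF_u (NF_u ih)
    · rw [vi, ← mul_assoc]; exact NF_v (NF_v ih)

def Ms : Matrix (Fin 2) (Fin 2) (ZMod 13) := !![1, 0; 0, 12]
def Mu : Matrix (Fin 2) (Fin 2) (ZMod 13) := !![2, 1; 6, 10]
def Mz3 : Matrix (Fin 2) (Fin 2) (ZMod 13) := !![5, 0; 0, 5]

theorem phi_z3 : (phi (z ^ 3) : Matrix (Fin 2) (Fin 2) (ZMod 13)) = Mz3 := by
  unfold z
  rw [map_pow, map_mul, map_mul, phi_s, phi_t, phi_u]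
  decide
theorem phi_z6 : (phi (z ^ 6) : Matrix (Fin 2) (Fin 2) (ZMod 13)) = !![12, 0; 0, 12] := by
  have : z ^ 6 = z ^ 3 * z ^ 3 := by rw [← pow_add]
  rw [this, map_mul, Units.val_mul, phi_z3]
  decide
theorem phi_u_b : (phi u : Matrix (Fin 2) (Fin 2) (ZMod 13)) = Mu := by
  rw [phi_u]; decide
theorem phi_v : (phi v : Matrix (Fin 2) (Fin 2) (ZMod 13)) = Ms * Mu * Ms := by
  unfold v
  rw [map_mul, map_mul, phi_s, phi_u]; decide
theorem phi_w : (phi w : Matrix (Fin 2) (Fin 2) (ZMod 13)) = Mz3 * Ms := by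
  unfold w
  rw [map_mul, Units.val_mul, phi_z3, phi_s]; decide

def A : Fin 2 → G7 := ![1, z ^ 6]
def B : Fin 3 → G7 := ![1, u, u ^ 2]
def C : Fin 4 → G7 := ![1, v, w, w * u]
def A_b : Fin 2 → Matrix (Fin 2) (Fin 2) (ZMod 13) := ![1, !![12, 0; 0, 12]]
def B_b : Fin 3 → Matrix (Fin 2) (Fin 2) (ZMod 13) := ![1, Mu, Mu * Mu]
def C_b : Fin 4 → Matrix (Fin 2) (Fin 2) (ZMod 13) :=
  ![1, Ms * Mu * Ms, Mz3 * Ms, Mz3 * Ms * Mu]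

theorem phi_A (i : Fin 2) : (phi (A i) : Matrix (Fin 2) (Fin 2) (ZMod 13)) = A_b i := by
  fin_cases i <;> simp [A, A_b, -map_pow, phi_z6]
theorem phi_B (i : Fin 3) : (phi (B i) : Matrix (Fin 2) (Fin 2) (ZMod 13)) = B_b i := by
  fin_cases i <;> simp [B, B_b, phi_u_b, sq]
theorem phi_C (i : Fin 4) : (phi (C i) : Matrix (Fin 2) (Fin 2) (ZMod 13)) = C_b i := by
  fin_cases i <;> simp [C, C_b, phi_u_b, phi_v, phi_w]

set_option maxRecDepth 100000 in
theorem inj_b : Function.Injective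
    (fun p : Fin 2 × Fin 3 × Fin 4 => A_b p.1 * B_b p.2.1 * C_b p.2.2) := by
  decide

theorem inj : Function.Injective
    (fun p : Fin 2 × Fin 3 × Fin 4 => A p.1 * B p.2.1 * C p.2.2) := by
  intro p q h
  apply inj_b
  have := congrArg (fun g => (phi g : Matrix (Fin 2) (Fin 2) (ZMod 13))) h
  simpa only [map_mul, Units.val_mul, phi_A, phi_B, phi_C] using this

theorem statement7 :
    ({1, v, w, w * u} : Set G7) =
      (({1, s, s * u, s * u * s} : Set G7) ∪
        z ^ 3 • ({1, s, s * u, s * u * s} : Set G7)) ∩ (G4 : Set G7) ∧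
    Set.BijOn (fun p : G7 × G7 × G7 => p.1 * p.2.1 * p.2.2)
      (({1, z ^ 6} : Set G7) ×ˢ (({1, u, u ^ 2} : Set G7) ×ˢ ({1, v, w, w * u} : Set G7)))
      (G4 : Set G7) := by
  have hX : ∀ x ∈ ({1, v, w, w * u} : Set G7), x ∈ G4 := by
    intro x hx
    simp only [Set.mem_insert_iff, Set.mem_singleton_iff] at hx
    rcases hx with rfl | rfl | rfl | rfl
    exacts [one_mem _, vG, wG, mul_mem wG uG]
  refine ⟨?_, ?_, ?_, ?_⟩
  · apply Set.Subset.antisymm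
    · intro x hx
      refine ⟨?_, hX x hx⟩
      simp only [Set.mem_insert_iff, Set.mem_singleton_iff] at hx
      rcases hx with rfl | rfl | rfl | rfl
      · left; simp
      · left; simp [v]
      · right; exact Set.smul_mem_smul_set (by simp : s ∈ _)
      · right
        have : w * u = z ^ 3 • (s * u) := by simp [w, mul_assoc]
        rw [this]; exact Set.smul_mem_smul_set (by simp)
    · rintro x ⟨hx | hx, hG⟩
      · have hp := psi_G4 x hG
        simp only [Set.mem_insert_iff, Set.mem_singleton_iff] at hx
        rcases hx with rfl | rfl | rfl | rfl
        · simp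
        · rw [psi_s] at hp; exact absurd hp (by decide)
        · rw [map_mul, psi_s, psi_u] at hp; exact absurd hp (by decide)
        · simp [v]
      · have hp := psi_G4 x hG
        rw [Set.mem_smul_set] at hx
        obtain ⟨y, hy, rfl⟩ := hx
        simp only [Set.mem_insert_iff, Set.mem_singleton_iff] at hy
        rw [smul_eq_mul] at hp ⊢
        have hz : psi (z ^ 3) = P 0 := by
          unfold z
          rw [map_pow, map_mul, map_mul, psi_s, psi_t, psi_u]; decide
        rcases hy with rfl | rfl | rfl | rfl
        · rw [map_mul, hz, map_one] at hp; exact absurd hp (by decide)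
        · simp [w]
        · simp [w, mul_assoc]
        · rw [map_mul, hz, map_mul, map_mul, psi_s, psi_u] at hp; exact absurd hp (by decide)
  · rintro ⟨a, b, x⟩ ⟨ha, hb, hx⟩
    simp only [Set.mem_insert_iff, Set.mem_singleton_iff] at ha hb
    refine mul_mem (mul_mem ?_ ?_) (hX x hx)
    · rcases ha with rfl | rfl
      · exact one_mem _
      · rw [← ww]; exact mul_mem wG wG
    · rcases hb with rfl | rfl | rfl
      exacts [one_mem _, uG, pow_mem uG 2]
  · have hA : ∀ a ∈ ({1, z ^ 6} : Set G7), ∃ i, A i = a := by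
      rintro a (rfl | rfl)
      exacts [⟨0, rfl⟩, ⟨1, rfl⟩]
    have hB : ∀ a ∈ ({1, u, u ^ 2} : Set G7), ∃ i, B i = a := by
      rintro a (rfl | rfl | rfl)
      exacts [⟨0, rfl⟩, ⟨1, rfl⟩, ⟨2, rfl⟩]
    have hC : ∀ a ∈ ({1, v, w, w * u} : Set G7), ∃ i, C i = a := by
      rintro a (rfl | rfl | rfl | rfl)
      exacts [⟨0, rfl⟩, ⟨1, rfl⟩, ⟨2, rfl⟩, ⟨3, rfl⟩]
    rintro ⟨a, b, x⟩ ⟨ha, hb, hx⟩ ⟨a_b, b_b, x_b⟩ ⟨ha_b, hb_b, hx_b⟩ h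
    obtain ⟨i, rfl⟩ := hA _ ha
    obtain ⟨j, rfl⟩ := hB _ hb
    obtain ⟨k, rfl⟩ := hC _ hx
    obtain ⟨i_b, rfl⟩ := hA _ ha_b
    obtain ⟨j_b, rfl⟩ := hB _ hb_b
    obtain ⟨k_b, rfl⟩ := hC _ hx_b
    have := @inj (i, j, k) (i_b, j_b, k_b) h
    simp only [Prod.mk.injEq] at this
    obtain ⟨rfl, rfl, rfl⟩ := this
    rfl
  · intro g hg
    obtain ⟨i, j, x, hx, rfl⟩ := NF_G4 hg
    obtain ⟨-, -, -, -, -, cc, -⟩ := grp_facts u3 uvu vuv v3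
    refine ⟨((w * w) ^ i, u ^ j, x), ⟨?_, ?_, hx⟩, rfl⟩
    · rw [pow_eq_pow_mod i cc]
      have := Nat.mod_lt i (show 0 < 2 by norm_num)
      interval_cases (i % 2)
      · simp
      · simp [ww]
    · show u ^ j ∈ _
      rw [pow_eq_pow_mod j u3]
      have := Nat.mod_lt j (show 0 < 3 by norm_num)
      interval_cases (j % 3) <;> simp

end Tetra
end

section
/- Let G₉ be the subgroup of G₁₁ generated by s and u. Then z³ = (s·t·u)³ = s·u·s·u·s·u = u·s·u·s·u·s, the element z³ has order 8, the center of G₉ equals the cyclic subgroup generated by z³, and Z(G₉) = G₉ ∩ Z(G₁₁). -/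
open Pointwise

namespace Octa

def rels : Set (FreeGroup (Fin 3)) :=
  { FreeGroup.of 0 ^ 2, FreeGroup.of 1 ^ 3, FreeGroup.of 2 ^ 4,
    FreeGroup.of 0 * FreeGroup.of 1 * FreeGroup.of 2 *
      (FreeGroup.of 1 * FreeGroup.of 2 * FreeGroup.of 0)⁻¹,
    FreeGroup.of 0 * FreeGroup.of 1 * FreeGroup.of 2 *
      (FreeGroup.of 2 * FreeGroup.of 0 * FreeGroup.of 1)⁻¹ }

/-- The group `G₁₁ = ⟨s, t, u | s² = t³ = u⁴ = 1, stu = tus = ust⟩`. -/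
abbrev G11 := PresentedGroup rels

def s : G11 := PresentedGroup.of 0
def t : G11 := PresentedGroup.of 1
def u : G11 := PresentedGroup.of 2
def z : G11 := s * t * u

def G9 : Subgroup G11 := Subgroup.closure {s, u}

theorem s_sq : s * s = 1 := by
  have h : (PresentedGroup.mk rels (FreeGroup.of 0 ^ 2)) = 1 :=
    PresentedGroup.one_of_mem (by simp [rels])
  rw [map_pow, pow_two] at h
  exact h

theorem t_cube : t * t * t = 1 := by
  have h : (PresentedGroup.mk rels (FreeGroup.of 1 ^ 3)) = 1 :=
    PresentedGroup.one_of_mem (by simp [rels])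
  rw [map_pow, pow_succ, pow_two] at h
  exact h

theorem u_four : u ^ 4 = 1 := by
  have h : (PresentedGroup.mk rels (FreeGroup.of 2 ^ 4)) = 1 :=
    PresentedGroup.one_of_mem (by simp [rels])
  rw [map_pow] at h
  exact h

theorem z_eq1 : z = t * u * s := by
  have h : (PresentedGroup.mk rels (FreeGroup.of 0 * FreeGroup.of 1 * FreeGroup.of 2 *
      (FreeGroup.of 1 * FreeGroup.of 2 * FreeGroup.of 0)⁻¹)) = 1 :=
    PresentedGroup.one_of_mem (by simp [rels])
  rw [map_mul, map_inv, mul_inv_eq_one] at h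
  simp only [map_mul] at h
  exact h

theorem z_eq2 : z = u * s * t := by
  have h : (PresentedGroup.mk rels (FreeGroup.of 0 * FreeGroup.of 1 * FreeGroup.of 2 *
      (FreeGroup.of 2 * FreeGroup.of 0 * FreeGroup.of 1)⁻¹)) = 1 :=
    PresentedGroup.one_of_mem (by simp [rels])
  rw [map_mul, map_inv, mul_inv_eq_one] at h
  simp only [map_mul] at h
  exact h

theorem z_def : z = s * t * u := rfl

theorem s_inv : s⁻¹ = s := inv_eq_of_mul_eq_one_left s_sq

theorem zs : z * s = s * z := by
  conv_rhs => rw [z_eq1]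
  rw [z_def]; group

theorem zu : z * u = u * z := by
  conv_lhs => rw [z_eq2]
  rw [z_def]; group

theorem t_eq : t = z * s * u⁻¹ := by
  rw [zs, z_def, ← mul_assoc, ← mul_assoc, s_sq]; group

theorem closure_stu : Subgroup.closure ({s, t, u} : Set G11) = ⊤ := by
  rw [← PresentedGroup.closure_range_of rels]
  congr 1
  ext x
  constructor
  · rintro (rfl | rfl | rfl)
    exacts [⟨0, rfl⟩, ⟨1, rfl⟩, ⟨2, rfl⟩]
  · rintro ⟨i, rfl⟩
    fin_cases i
    · exact Or.inl rfl
    · exact Or.inr (Or.inl rfl)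
    · exact Or.inr (Or.inr rfl)

theorem central_of (g : G11) (hs : g * s = s * g) (ht : g * t = t * g) (hu : g * u = u * g) :
    g ∈ Subgroup.center G11 := by
  have h : Subgroup.closure ({s, t, u} : Set G11) ≤ Subgroup.centralizer {g} := by
    rw [Subgroup.closure_le]
    rintro x (rfl | rfl | rfl) <;>
      simp only [SetLike.mem_coe, Subgroup.mem_centralizer_singleton_iff] <;>
      first | assumption | (symm; assumption)
  rw [closure_stu] at h
  rw [Subgroup.mem_center_iff]
  intro x
  have := h (Subgroup.mem_top x)
  rw [Subgroup.mem_centralizer_singleton_iff] at this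
  exact this

theorem zt : z * t = t * z := by
  have h1 : Commute z s := zs
  have h2 : Commute z u := zu
  have : Commute z t := by
    rw [t_eq]
    exact ((Commute.refl z).mul_right h1).mul_right h2.inv_right
  exact this

theorem z_central : z ∈ Subgroup.center G11 := central_of z zs zt zu

theorem zc (x : G11) (n : ℤ) : z ^ n * x = x * z ^ n :=
  ((Subgroup.mem_center_iff.1 (Subgroup.zpow_mem _ z_central n)) x).symm

theorem zcn (x : G11) (n : ℕ) : z ^ n * x = x * z ^ n :=
  ((Subgroup.mem_center_iff.1 (Subgroup.pow_mem _ z_central n)) x).symm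

theorem z1 (x : G11) : z * x = x * z :=
  ((Subgroup.mem_center_iff.1 z_central) x).symm

/-- `z³ (s u⁻¹)³ = 1` rewritten. -/
theorem z3_us : z ^ 3 = u * s * u * s * u * s := by
  have h := t_cube
  have h3 : (z * (s * u⁻¹)) ^ 3 = 1 := by
    rw [← mul_assoc, ← t_eq, pow_succ, pow_two, h]
  have hc : Commute z (s * u⁻¹) := z1 _
  rw [hc.mul_pow, mul_eq_one_iff_eq_inv] at h3
  rw [h3, ← inv_pow, mul_inv_rev, s_inv, inv_inv]
  simp only [pow_succ, pow_zero, one_mul, mul_assoc]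

theorem z3_su : z ^ 3 = s * u * s * u * s * u := by
  have h := zcn s 3
  have : z ^ 3 = s * z ^ 3 * s := by rw [← h, mul_assoc, s_sq, mul_one]
  rw [this, z3_us]
  simp only [mul_assoc, s_sq, mul_one]

/-- Coset representatives for `⟨z, u⟩`. -/
def rep {G : Type*} [Group G] (a b : G) : Fin 6 → G :=
  ![1, a, b * a, b ^ 2 * a, b ^ 3 * a, a * b ^ 2 * a]

theorem s_mul (x : G11) : s * (s * x) = x := by rw [← mul_assoc, s_sq, one_mul]

theorem u3 : u ^ 3 = u⁻¹ := by
  rw [eq_inv_iff_mul_eq_one, ← pow_succ, u_four]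

theorem sus : s * u * s = u⁻¹ * s * (z ^ 3 * u⁻¹) := by
  rw [zcn, ← mul_assoc, ← zcn, z3_su]
  simp only [mul_assoc, mul_inv_cancel_left, s_mul, mul_inv_cancel, mul_one]

theorem usu : u * s * u = s * u⁻¹ * s * z ^ 3 := by
  rw [← zcn, z3_us]
  simp only [mul_assoc, mul_inv_cancel_left, s_mul, s_sq, mul_one]

theorem s_rep (i : Fin 6) :
    ∃ j : Fin 6, ∃ a b : ℤ, s * rep s u i = rep s u j * (z ^ a * u ^ b) := by
  fin_cases i
  · exact ⟨1, 0, 0, by simp [rep]⟩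
  · exact ⟨0, 0, 0, by simp [rep, s_sq]⟩
  · refine ⟨4, 3, -1, ?_⟩
    have := sus
    simp only [rep, u3]
    simpa [mul_assoc] using this
  · exact ⟨5, 0, 0, by simp [rep, mul_assoc]⟩
  · refine ⟨2, -3, 1, ?_⟩
    have := usu
    have h : s * u⁻¹ * s = u * s * u * (z ^ 3)⁻¹ := by rw [this]; group
    have h2 : (z ^ 3)⁻¹ = z ^ (-3 : ℤ) := by group
    rw [h2, mul_assoc (u * s), ← zc] at h
    simpa [rep, u3, mul_assoc] using h
  · exact ⟨3, 0, 0, by simp [rep, mul_assoc, s_mul]⟩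

theorem u_sq_inv : u ^ 2 = u⁻¹ * u⁻¹ := by
  rw [← mul_inv_rev, eq_inv_iff_mul_eq_one, ← pow_two, ← pow_add, u_four]

theorem u_rep (i : Fin 6) :
    ∃ j : Fin 6, ∃ a b : ℤ, u * rep s u i = rep s u j * (z ^ a * u ^ b) := by
  fin_cases i
  · exact ⟨0, 0, 1, by simp [rep]⟩
  · exact ⟨2, 0, 0, by simp [rep]⟩
  · exact ⟨3, 0, 0, by simp [rep, pow_two, mul_assoc]⟩
  · exact ⟨4, 0, 0, by simp [rep, pow_succ, mul_assoc]⟩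
  · refine ⟨1, 0, 0, ?_⟩
    simp [rep, u3]
  · refine ⟨5, 6, -1, ?_⟩
    have h : u * (s * u ^ 2 * s) = s * u ^ 2 * s * (z ^ 6 * u⁻¹) := by
      calc u * (s * u ^ 2 * s) = (u * s * u) * u * s := by
            simp only [pow_two, mul_assoc]
        _ = s * u⁻¹ * z ^ 3 * (s * u * s) := by
            rw [usu, mul_assoc (s * u⁻¹), ← zcn]; simp only [mul_assoc]
        _ = s * u ^ 2 * s * (z ^ 6 * u⁻¹) := by
            rw [sus, u_sq_inv, mul_assoc (s * u⁻¹), zcn, show (6 : ℕ) = 3 + 3 from rfl, pow_add]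
            rw [mul_assoc (u⁻¹ * s), mul_assoc (z ^ 3), ← zcn u⁻¹]
            simp only [mul_assoc]
    simpa [rep] using h

def NF (g : G11) : Prop := ∃ i : Fin 6, ∃ a b : ℤ, g = rep s u i * (z ^ a * u ^ b)

theorem NF_mul_K {x : G11} (h : NF x) (a b : ℤ) : NF (x * (z ^ a * u ^ b)) := by
  obtain ⟨i, c, d, rfl⟩ := h
  refine ⟨i, c + a, d + b, ?_⟩
  rw [zpow_add, zpow_add, mul_assoc, mul_assoc (z ^ c), ← mul_assoc (u ^ d), ← zc (u ^ d) a]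
  simp only [mul_assoc]

theorem NF_s {x : G11} (h : NF x) : NF (s * x) := by
  obtain ⟨i, c, d, rfl⟩ := h
  rw [← mul_assoc]
  exact NF_mul_K (s_rep i) c d

theorem NF_u {x : G11} (h : NF x) : NF (u * x) := by
  obtain ⟨i, c, d, rfl⟩ := h
  rw [← mul_assoc]
  exact NF_mul_K (u_rep i) c d

theorem NF_z {x : G11} (h : NF x) : NF (z * x) := by
  rw [z1]
  simpa using NF_mul_K h 1 0

theorem NF_uinv {x : G11} (h : NF x) : NF (u⁻¹ * x) := by
  rw [← u3]
  have := NF_u (NF_u (NF_u h))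
  simpa [pow_succ, mul_assoc] using this

theorem NF_t {x : G11} (h : NF x) : NF (t * x) := by
  rw [t_eq, mul_assoc, mul_assoc]
  exact NF_z (NF_s (NF_uinv h))

theorem NF_all (g : G11) : NF g := by
  have hg : g ∈ Subgroup.closure ({s, t, u} : Set G11) := by
    rw [closure_stu]; exact Subgroup.mem_top g
  induction hg using Subgroup.closure_induction_left with
  | one => exact ⟨0, 0, 0, by simp [rep]⟩
  | mul_left x hx y hy ih =>
    rcases hx with rfl | rfl | rfl
    exacts [NF_s ih, NF_t ih, NF_u ih]
  | inv_mul_cancel x hx y hy ih =>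
    rcases hx with rfl | rfl | rfl
    · rw [s_inv]; exact NF_s ih
    · have : t⁻¹ = t * t := inv_eq_of_mul_eq_one_left t_cube
      rw [this, mul_assoc]; exact NF_t (NF_t ih)
    · exact NF_uinv ih

theorem NF_all' (g : G11) : ∃ i : Fin 6, ∃ a : ℤ, ∃ b : Fin 4,
    g = rep s u i * (z ^ a * u ^ (b : ℕ)) := by
  obtain ⟨i, a, b, h⟩ := NF_all g
  refine ⟨i, a, ⟨(b % 4).toNat, by omega⟩, ?_⟩
  rw [h]
  congr 2
  have h4 : u ^ (4 : ℤ) = 1 := by exact_mod_cast u_four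
  have : ((b % 4).toNat : ℤ) = b % 4 := by omega
  simp only
  rw [← zpow_natCast, this]
  conv_lhs => rw [← Int.emod_add_mul_ediv b 4, zpow_add, zpow_mul, h4, one_zpow, mul_one]

/-- Build homomorphisms out of `G11`. -/
theorem exists_hom {H : Type*} [Group H] (a b c : H) (h1 : a ^ 2 = 1) (h2 : b ^ 3 = 1)
    (h3 : c ^ 4 = 1) (h4 : a * b * c = b * c * a) (h5 : a * b * c = c * a * b) :
    ∃ f : G11 →* H, f s = a ∧ f t = b ∧ f u = c := by
  have hr : ∀ r ∈ rels, FreeGroup.lift ![a, b, c] r = 1 := by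
    rintro r (rfl | rfl | rfl | rfl | rfl)
    · simpa using h1
    · simpa using h2
    · simpa using h3
    · rw [map_mul, map_inv, mul_inv_eq_one]; simpa using h4
    · rw [map_mul, map_inv, mul_inv_eq_one]; simpa using h5
  refine ⟨PresentedGroup.toGroup hr, ?_, ?_, ?_⟩
  · exact PresentedGroup.toGroup.of hr
  · exact PresentedGroup.toGroup.of hr
  · exact PresentedGroup.toGroup.of hr

def ps : Equiv.Perm (Fin 4) := Equiv.swap 0 1
def pu : Equiv.Perm (Fin 4) := finRotate 4

theorem exists_phi : ∃ f : G11 →* Equiv.Perm (Fin 4), f s = ps ∧ f u = pu ∧ f z = 1 := by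
  obtain ⟨f, h1, h2, h3⟩ := exists_hom ps (ps * pu⁻¹) pu (by decide) (by decide) (by decide)
    (by decide) (by decide)
  refine ⟨f, h1, h3, ?_⟩
  rw [z_def, map_mul, map_mul, h1, h2, h3]
  decide

theorem perm_center : ∀ i : Fin 6, ∀ b : Fin 4,
    (rep ps pu i * pu ^ (b : ℕ)) * ps = ps * (rep ps pu i * pu ^ (b : ℕ)) →
    (rep ps pu i * pu ^ (b : ℕ)) * pu = pu * (rep ps pu i * pu ^ (b : ℕ)) → i = 0 ∧ b = 0 := by
  decide

theorem perm_surj : ∀ p : Equiv.Perm (Fin 4), ∃ i : Fin 6, ∃ b : Fin 4,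
    rep ps pu i * pu ^ (b : ℕ) = p := by
  decide

theorem map_rep {G H : Type*} [Group G] [Group H] (f : G →* H) (a b : G) (i : Fin 6) :
    f (rep a b i) = rep (f a) (f b) i := by
  fin_cases i <;> simp [rep]

theorem center_eq : Subgroup.center G11 = Subgroup.zpowers z := by
  apply le_antisymm
  · intro g hg
    obtain ⟨f, hs, hu, hz⟩ := exists_phi
    obtain ⟨i, a, b, h⟩ := NF_all' g
    have hf : f g = rep ps pu i * pu ^ (b : ℕ) := by
      rw [h, map_mul, map_rep, map_mul, map_zpow, map_pow, hs, hu, hz, one_zpow, one_mul]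
    rw [Subgroup.mem_center_iff] at hg
    have c1 := congrArg f (hg s)
    have c2 := congrArg f (hg u)
    rw [map_mul, map_mul, hs, hf] at c1
    rw [map_mul, map_mul, hu, hf] at c2
    obtain ⟨rfl, rfl⟩ := perm_center i b c1.symm c2.symm
    rw [h]
    exact ⟨a, by simp [rep]⟩
  · rw [Subgroup.zpowers_le]; exact z_central

theorem center_index : (Subgroup.center G11).index = 24 := by
  obtain ⟨f, hs, hu, hz⟩ := exists_phi
  have hsurj : Function.Surjective f := by
    intro p
    obtain ⟨i, b, h⟩ := perm_surj p
    exact ⟨rep s u i * u ^ (b : ℕ), by rw [map_mul, map_rep, map_pow, hs, hu, h]⟩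
  have hker : Subgroup.center G11 = f.ker := by
    apply le_antisymm
    · rw [center_eq, Subgroup.zpowers_le]; exact hz
    · intro g hg
      obtain ⟨i, a, b, h⟩ := NF_all' g
      have hf : f g = rep ps pu i * pu ^ (b : ℕ) := by
        rw [h, map_mul, map_rep, map_mul, map_zpow, map_pow, hs, hu, hz, one_zpow, one_mul]
      rw [MonoidHom.mem_ker] at hg
      rw [hg] at hf
      obtain ⟨rfl, rfl⟩ := perm_center i b (by rw [← hf]; simp) (by rw [← hf]; simp)
      rw [center_eq, h]
      exact ⟨a, by simp [rep]⟩
  rw [hker, Subgroup.index_ker, MonoidHom.range_eq_top.2 hsurj, Subgroup.card_top,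
    Nat.card_eq_fintype_card, Fintype.card_perm]
  rfl

theorem z24 : z ^ 24 = 1 := by
  have : (Subgroup.center G11).FiniteIndex := ⟨by rw [center_index]; norm_num⟩
  have key : ∀ g : G11, ((MonoidHom.transferCenterPow G11 g : Subgroup.center G11) : G11)
      = g ^ 24 := by
    intro g
    rw [MonoidHom.transferCenterPow_apply, center_index]
  rw [← key, z_def, map_mul, map_mul, Subgroup.coe_mul, Subgroup.coe_mul, key, key, key]
  have e1 : s ^ 24 = 1 := by
    rw [show 24 = 2 * 12 from rfl, pow_mul, pow_two, s_sq, one_pow]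
  have e2 : t ^ 24 = 1 := by
    have h3 : t ^ 3 = 1 := by rw [pow_succ, pow_two, t_cube]
    rw [show 24 = 3 * 8 from rfl, pow_mul, h3, one_pow]
  have e3 : u ^ 24 = 1 := by
    rw [show 24 = 4 * 6 from rfl, pow_mul, u_four, one_pow]
  rw [e1, e2, e3]; simp

/-- Reflections generating an image of `G11` in `GL₂(𝔽₁₇)`. -/
def ms : (Matrix (Fin 2) (Fin 2) (ZMod 17))ˣ :=
  ⟨!![3, 9; 1, 14], !![3, 9; 1, 14], by decide, by decide⟩
def mu : (Matrix (Fin 2) (Fin 2) (ZMod 17))ˣ :=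
  ⟨!![1, 0; 0, 4], !![1, 0; 0, 13], by decide, by decide⟩
def mz : (Matrix (Fin 2) (Fin 2) (ZMod 17))ˣ :=
  ⟨!![9, 0; 0, 9], !![2, 0; 0, 2], by decide, by decide⟩

theorem z12 : z ^ 12 ≠ 1 := by
  obtain ⟨f, h1, h2, h3⟩ := exists_hom ms (mz * ms * mu⁻¹) mu (by decide) (by decide) (by decide)
    (by decide) (by decide)
  intro h
  have := congrArg f h
  rw [z_def, map_pow, map_mul, map_mul, h1, h2, h3, map_one] at this
  revert this
  decide

theorem z3_mem : z ^ 3 ∈ G9 := by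
  have hs : s ∈ G9 := Subgroup.subset_closure (by simp)
  have hu : u ∈ G9 := Subgroup.subset_closure (by simp)
  rw [z3_su]
  exact mul_mem (mul_mem (mul_mem (mul_mem (mul_mem hs hu) hs) hu) hs) hu

theorem z_pow_mem {k : ℤ} (h : z ^ k ∈ G9) : (3 : ℤ) ∣ k := by
  obtain ⟨f, h1, h2, h3⟩ := exists_hom (1 : Multiplicative (ZMod 3))
    (Multiplicative.ofAdd 1) 1 (by decide) (by decide) (by decide) (by decide) (by decide)
  have hle : G9 ≤ f.ker := by
    unfold G9
    rw [Subgroup.closure_le]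
    rintro x (rfl | rfl)
    · exact h1
    · exact h3
  have := hle h
  rw [MonoidHom.mem_ker, map_zpow, z_def, map_mul, map_mul, h1, h2, h3, one_mul, mul_one,
    ← ofAdd_zsmul, ofAdd_eq_one] at this
  simp only [zsmul_eq_mul, mul_one] at this
  exact (ZMod.intCast_zmod_eq_zero_iff_dvd k 3).1 this

theorem G9_center : (Subgroup.center ↥G9).map G9.subtype = G9 ⊓ Subgroup.center G11 := by
  have hs : s ∈ G9 := Subgroup.subset_closure (by simp)
  have hu : u ∈ G9 := Subgroup.subset_closure (by simp)
  ext g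
  constructor
  · rintro ⟨x, hx, rfl⟩
    refine ⟨x.2, ?_⟩
    have hx' := Subgroup.mem_center_iff.1 hx
    have e1 : Commute (x : G11) s := (congrArg Subtype.val (hx' ⟨s, hs⟩)).symm
    have e2 : Commute (x : G11) u := (congrArg Subtype.val (hx' ⟨u, hu⟩)).symm
    have e3 : Commute (x : G11) z := (z1 _).symm
    have e4 : Commute (x : G11) t := by
      rw [t_eq]
      exact (e3.mul_right e1).mul_right e2.inv_right
    exact central_of _ e1 e4 e2
  · rintro ⟨h1, h2⟩
    refine ⟨⟨g, h1⟩, ?_, rfl⟩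
    refine Subgroup.mem_center_iff.2 fun y => Subtype.ext ?_
    exact Subgroup.mem_center_iff.1 h2 y

theorem G9_inf : G9 ⊓ Subgroup.center G11 = Subgroup.zpowers (z ^ 3) := by
  apply le_antisymm
  · rintro g ⟨h1, h2⟩
    rw [center_eq] at h2
    obtain ⟨k, rfl⟩ := h2
    obtain ⟨m, rfl⟩ := z_pow_mem h1
    refine ⟨m, ?_⟩
    simp only [zpow_mul]
    norm_cast
  · rw [Subgroup.zpowers_le]
    exact ⟨z3_mem, Subgroup.pow_mem _ z_central 3⟩

theorem statement9 :
    z ^ 3 = s * u * s * u * s * u ∧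
    z ^ 3 = u * s * u * s * u * s ∧
    orderOf (z ^ 3) = 8 ∧
    (Subgroup.center ↥G9).map G9.subtype = Subgroup.zpowers (z ^ 3) ∧
    (Subgroup.center ↥G9).map G9.subtype = G9 ⊓ Subgroup.center G11 := by
  refine ⟨z3_su, z3_us, ?_, G9_center.trans G9_inf, G9_center⟩
  have h := orderOf_eq_prime_pow (x := z ^ 3) (p := 2) (n := 2)
    (by rw [← pow_mul]; exact z12) (by rw [← pow_mul]; exact z24)
  exact h

end Octa
end
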